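/- Let h : ℝ^d → ℝ be smooth and compactly supported, let p ≥ 0, and let [h]_{α,p} be a common α-Hölder constant for all partial derivatives of order p of h, where α ∈ (0,1]. Let f_h(x) = −∫₀¹ (1/(2t)) E[ h̄(√t x + √(1−t) Z) ] dt with h̄ = h − E h(Z), Z ~ N(0, I_d). Then for every β ∈ (0, α), all partial derivatives of order p+2 of f_h are β-Hölder: for all indices (i₁,…,i_{p+2}) ∈ {1,…,d}^{p+2} and all x, y ∈ ℝ^d, |∂^{p+2}f_h/(∂x_{i₁}…∂x_{i_{p+2}})(x) − ∂^{p+2}f_h/(∂x_{i₁}…∂x_{i_{p+2}})(y)| ≤ [h]_{α,p} (A + 2/(α−β)) |x−y|^β, where A = 2^{α/2+1} ((α+d+1)/α) Γ((α+d)/2)/Γ(d/2). -/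

import Mathlib

open MeasureTheory ProbabilityTheory Real Filter Set

noncomputable section

/-- The standard Gaussian measure `N(0, I_d)` on `ℝ^d` (as `EuclideanSpace ℝ (Fin d)`). -/
def stdGaussian (d : ℕ) : Measure (EuclideanSpace ℝ (Fin d)) :=
  (Measure.pi fun _ : Fin d => gaussianReal 0 1).map
    ⇑(EuclideanSpace.equiv (Fin d) ℝ).symm

/-- Partial derivative in the `j`-th coordinate direction. -/
def pderivI {d : ℕ} (j : Fin d) (f : EuclideanSpace ℝ (Fin d) → ℝ) :
    EuclideanSpace ℝ (Fin d) → ℝ :=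
  fun x => fderiv ℝ f x (EuclideanSpace.single j 1)

/-- Iterated partial derivative along a list of coordinate directions (head applied last,
i.e. outermost). -/
def pderivList {d : ℕ} : List (Fin d) → (EuclideanSpace ℝ (Fin d) → ℝ) →
    EuclideanSpace ℝ (Fin d) → ℝ
  | [], f => f
  | j :: l, f => pderivI j (pderivList l f)

/-- Multi-index partial derivative `∂^{|m|}/(∂x₁^{m₁} ⋯ ∂x_d^{m_d})`. -/
def pderivMulti {d : ℕ} (m : Fin d → ℕ) (f : EuclideanSpace ℝ (Fin d) → ℝ) :
    EuclideanSpace ℝ (Fin d) → ℝ :=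
  pderivList ((List.finRange d).flatMap fun j => List.replicate (m j) j) f

/-- Multivariate Hermite polynomial
`H_m(x) = (-1)^{|m|} e^{|x|²/2} ∂^{|m|}/(∂x₁^{m₁} ⋯ ∂x_d^{m_d}) e^{-|x|²/2}`. -/
def hermiteMulti {d : ℕ} (m : Fin d → ℕ) (x : EuclideanSpace ℝ (Fin d)) : ℝ :=
  (-1 : ℝ) ^ (∑ j, m j) * Real.exp (‖x‖ ^ 2 / 2) *
    pderivMulti m (fun y => Real.exp (-‖y‖ ^ 2 / 2)) x

/-- `h̄ = h - E h(Z)` with `Z ~ N(0, I_d)`. -/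
def hbar (d : ℕ) (h : EuclideanSpace ℝ (Fin d) → ℝ) (x : EuclideanSpace ℝ (Fin d)) : ℝ :=
  h x - ∫ z, h z ∂(stdGaussian d)

/-- Barbour's solution `f_h(x) = -∫₀¹ (1/(2t)) E[ h̄(√t x + √(1-t) Z) ] dt` of the
multivariate Stein equation. -/
def steinSol (d : ℕ) (h : EuclideanSpace ℝ (Fin d) → ℝ) (x : EuclideanSpace ℝ (Fin d)) : ℝ :=
  -∫ t in Ioo (0 : ℝ) 1,
      (1 / (2 * t)) *
        ∫ z, hbar d h (Real.sqrt t • x + Real.sqrt (1 - t) • z) ∂(stdGaussian d)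

/-- Entry `(i, j)` of the Hessian matrix of `f` at `x`. -/
def hessEntry {d : ℕ} (f : EuclideanSpace ℝ (Fin d) → ℝ) (x : EuclideanSpace ℝ (Fin d))
    (i j : Fin d) : ℝ :=
  pderivI i (pderivI j f) x

/-- The Hessian matrix `∇² f(x)`. -/
def hessMatrix {d : ℕ} (f : EuclideanSpace ℝ (Fin d) → ℝ) (x : EuclideanSpace ℝ (Fin d)) :
    Matrix (Fin d) (Fin d) ℝ :=
  Matrix.of fun i j => hessEntry f x i j

/-- Operator norm `‖M‖_op = sup_{|v| = 1} |M v|` (Euclidean norms) of a `d × d` matrix. -/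
def matOpNorm {d : ℕ} (M : Matrix (Fin d) (Fin d) ℝ) : ℝ :=
  sSup { r | ∃ v : EuclideanSpace ℝ (Fin d), ‖v‖ = 1 ∧
    r = ‖(WithLp.equiv 2 (Fin d → ℝ)).symm (M.mulVec ((WithLp.equiv 2 (Fin d → ℝ)) v))‖ }

/-- The Laplacian `Δ f(x) = ∑ i ∂²f/∂x_i²(x)`. -/
def laplacian {d : ℕ} (f : EuclideanSpace ℝ (Fin d) → ℝ) (x : EuclideanSpace ℝ (Fin d)) : ℝ :=
  ∑ i, hessEntry f x i i

/-- `C` is an `α`-Hölder constant for `h`. -/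
def HolderConst {d : ℕ} (α C : ℝ) (h : EuclideanSpace ℝ (Fin d) → ℝ) : Prop :=
  ∀ x y, |h x - h y| ≤ C * dist x y ^ α

/-- The 1-Wasserstein distance in dual form: sup over 1-Lipschitz test functions. -/
def wasserstein1 {d : ℕ} (μ ν : Measure (EuclideanSpace ℝ (Fin d))) : ℝ :=
  sSup { r | ∃ h : EuclideanSpace ℝ (Fin d) → ℝ, LipschitzWith 1 h ∧
    r = (∫ x, h x ∂μ) - ∫ x, h x ∂ν }

/-- The `α`-Wasserstein distance: sup over continuous `h` with `[h]_α ≤ 1`. -/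
def wassersteinHolder {d : ℕ} (α : ℝ) (μ ν : Measure (EuclideanSpace ℝ (Fin d))) : ℝ :=
  sSup { r | ∃ h : EuclideanSpace ℝ (Fin d) → ℝ, Continuous h ∧ HolderConst α 1 h ∧
    r = (∫ x, h x ∂μ) - ∫ x, h x ∂ν }

/-- The constant `C₁(α, d)`. -/
def C1 (α : ℝ) (d : ℕ) : ℝ :=
  2 ^ (α / 2 + 1) * ((α + 2 * d) / (α * d)) * Real.Gamma ((α + d) / 2) / Real.Gamma (d / 2)

/-- The constant `C₂(α, d)`. -/
def C2 (α : ℝ) (d : ℕ) : ℝ :=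
  if α = 1 then 2 * Real.sqrt (2 / π) * Real.sqrt d
  else 2 ^ (α / 2 + 1) * (α + 2 * d) * Real.Gamma ((α + d) / 2) / (α * Real.Gamma (d / 2))

end
/-- The density of the standard Gaussian measure with respect to Lebesgue measure. -/
noncomputable def stdGaussianDensity (d : ℕ) (z : EuclideanSpace ℝ (Fin d)) : ℝ :=
  (Real.sqrt (2 * π))⁻¹ ^ d * Real.exp (-‖z‖ ^ 2 / 2)

lemma stdGaussianDensity_nonneg (d : ℕ) (z : EuclideanSpace ℝ (Fin d)) :
    0 ≤ stdGaussianDensity d z := by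
  unfold stdGaussianDensity; positivity

lemma contDiff_stdGaussianDensity (d : ℕ) : ContDiff ℝ (⊤ : ℕ∞) (stdGaussianDensity d) := by
  unfold stdGaussianDensity
  exact contDiff_const.mul ((((contDiff_id.norm_sq ℝ).neg).div_const 2).exp)

lemma stdGaussianDensity_eq_prod (d : ℕ) (z : EuclideanSpace ℝ (Fin d)) :
    stdGaussianDensity d z = ∏ i, gaussianPDFReal 0 1 (z i) := by
  simp only [stdGaussianDensity, gaussianPDFReal, Finset.prod_mul_distrib, Finset.prod_const,
    Finset.card_univ, Fintype.card_fin, ← Real.exp_sum, EuclideanSpace.real_norm_sq_eq]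
  simp [← Finset.sum_div, Finset.sum_neg_distrib]

lemma pi_gaussianReal_eq_withDensity (d : ℕ) :
    (Measure.pi fun _ : Fin d => gaussianReal 0 1) =
      volume.withDensity fun x : Fin d → ℝ =>
        ENNReal.ofReal (∏ i, gaussianPDFReal 0 1 (x i)) := by
  refine Measure.pi_eq fun s hs => ?_
  have hint : Integrable (fun x : Fin d → ℝ => ∏ i, (s i).indicator (gaussianPDFReal 0 1) (x i)) :=
    Integrable.fintype_prod fun i => (integrable_gaussianPDFReal 0 1).indicator (hs i)
  rw [withDensity_apply _ (MeasurableSet.univ_pi hs),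
    ← lintegral_indicator (MeasurableSet.univ_pi hs)]
  have heq : ∀ x : Fin d → ℝ, (Set.univ.pi s).indicator
      (fun x => ENNReal.ofReal (∏ i, gaussianPDFReal 0 1 (x i))) x =
      ENNReal.ofReal (∏ i, (s i).indicator (gaussianPDFReal 0 1) (x i)) := by
    intro x
    by_cases hx : x ∈ Set.univ.pi s
    · rw [Set.indicator_of_mem hx]
      congr 1
      exact Finset.prod_congr rfl fun i _ => (Set.indicator_of_mem (hx i trivial) _).symm
    · rw [Set.indicator_of_notMem hx]
      simp only [Set.mem_pi, Set.mem_univ, true_implies, not_forall] at hx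
      obtain ⟨i, hi⟩ := hx
      rw [Finset.prod_eq_zero (Finset.mem_univ i) (Set.indicator_of_notMem hi _),
        ENNReal.ofReal_zero]
  simp_rw [heq]
  rw [← ofReal_integral_eq_lintegral_ofReal hint (ae_of_all _ fun x =>
    Finset.prod_nonneg fun i _ => Set.indicator_nonneg (fun y _ => gaussianPDFReal_nonneg 0 1 y) _),
    integral_fintype_prod_volume_eq_prod, ENNReal.ofReal_prod_of_nonneg]
  · refine Finset.prod_congr rfl fun i _ => ?_
    rw [gaussianReal_apply_eq_integral _ one_ne_zero, integral_indicator (hs i)]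
  · exact fun i _ => integral_nonneg fun y =>
      Set.indicator_nonneg (fun y _ => gaussianPDFReal_nonneg 0 1 y) _

lemma stdGaussian_eq_withDensity (d : ℕ) :
    _root_.stdGaussian d =
      volume.withDensity fun z => ENNReal.ofReal (stdGaussianDensity d z) := by
  have hmp : MeasurePreserving (⇑(EuclideanSpace.equiv (Fin d) ℝ).symm) volume volume :=
    PiLp.volume_preserving_toLp (Fin d)
  have hme : MeasurableEmbedding (⇑(EuclideanSpace.equiv (Fin d) ℝ).symm) :=
    (EuclideanSpace.equiv (Fin d) ℝ).symm.toHomeomorph.measurableEmbedding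
  rw [_root_.stdGaussian, pi_gaussianReal_eq_withDensity]
  ext s hs
  rw [hme.map_apply, withDensity_apply _ (hme.measurable hs), withDensity_apply _ hs,
    ← hmp.setLIntegral_comp_preimage_emb hme]
  simp_rw [stdGaussianDensity_eq_prod]
  rfl

instance isProbabilityMeasure_stdGaussian' (d : ℕ) :
    IsProbabilityMeasure (_root_.stdGaussian d) :=
  Measure.isProbabilityMeasure_map
    (EuclideanSpace.equiv (Fin d) ℝ).symm.continuous.measurable.aemeasurable

lemma integral_stdGaussian (d : ℕ) (F : EuclideanSpace ℝ (Fin d) → ℝ) :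
    ∫ z, F z ∂(_root_.stdGaussian d) = ∫ z, F z * stdGaussianDensity d z := by
  rw [stdGaussian_eq_withDensity, integral_withDensity_eq_integral_toReal_smul
    (contDiff_stdGaussianDensity d).continuous.measurable.ennreal_ofReal (by simp)]
  simp [ENNReal.toReal_ofReal (stdGaussianDensity_nonneg d _), mul_comm]

lemma integrable_stdGaussian_iff (d : ℕ) (F : EuclideanSpace ℝ (Fin d) → ℝ) :
    Integrable F (_root_.stdGaussian d) ↔
      Integrable fun z => F z * stdGaussianDensity d z := by
  rw [stdGaussian_eq_withDensity, integrable_withDensity_iff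
    (contDiff_stdGaussianDensity d).continuous.measurable.ennreal_ofReal (by simp)]
  simp [ENNReal.toReal_ofReal (stdGaussianDensity_nonneg d _)]

/-- `∫ y^{d-1+s} e^{-y²/2} dy` over the half line. -/
lemma radial_integral {d : ℕ} (hd : 1 ≤ d) {s : ℝ} (hs : 0 ≤ s) :
    IntegrableOn (fun y : ℝ => y ^ (d - 1) * (y ^ s * Real.exp (-y ^ 2 / 2))) (Ioi 0) ∧
    ∫ y in Ioi (0 : ℝ), y ^ (d - 1) * (y ^ s * Real.exp (-y ^ 2 / 2)) =
      2 ^ ((s + d) / 2) * 2⁻¹ * Real.Gamma ((s + d) / 2) := by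
  have hq : -1 < (d - 1 : ℝ) + s := by
    have : (1 : ℝ) ≤ d := by exact_mod_cast hd
    linarith
  have heq : ∀ y ∈ Ioi (0 : ℝ), y ^ ((d - 1 : ℝ) + s) * Real.exp (-(1 / 2) * y ^ (2 : ℝ)) =
      y ^ (d - 1) * (y ^ s * Real.exp (-y ^ 2 / 2)) := by
    intro y hy
    rw [Real.rpow_add hy, Real.rpow_two, ← Nat.cast_one, ← Nat.cast_sub hd, Real.rpow_natCast,
      mul_assoc]
    congr 3
    ring_nf
  constructor
  · refine (integrableOn_congr_fun heq measurableSet_Ioi).1 ?_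
    exact integrableOn_rpow_mul_exp_neg_mul_rpow hq (by norm_num) (by norm_num)
  · rw [← setIntegral_congr_fun measurableSet_Ioi heq,
      integral_rpow_mul_exp_neg_mul_rpow (by norm_num) hq (by norm_num)]
    have : (d - 1 : ℝ) + s + 1 = s + d := by ring
    rw [show -((d - 1 : ℝ) + s + 1) / 2 = -((s + d) / 2) by ring, this, one_div,
      Real.inv_rpow (by norm_num), Real.rpow_neg (by norm_num), inv_inv]

lemma integrable_norm_rpow_stdGaussian {d : ℕ} (hd : 1 ≤ d) {s : ℝ} (hs : 0 ≤ s) :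
    Integrable (fun z => ‖z‖ ^ s) (_root_.stdGaussian d) := by
  have : Nonempty (Fin d) := ⟨⟨0, hd⟩⟩
  rw [integrable_stdGaussian_iff]
  have := (integrable_fun_norm_addHaar (volume : Measure (EuclideanSpace ℝ (Fin d)))
    (f := fun y => y ^ s * Real.exp (-y ^ 2 / 2))).2 (by
      simpa using (radial_integral hd hs).1)
  refine (this.const_mul ((Real.sqrt (2 * π))⁻¹ ^ d)).congr (ae_of_all _ fun z => ?_)
  simp only [stdGaussianDensity]
  ring

lemma integral_norm_rpow_stdGaussian {d : ℕ} (hd : 1 ≤ d) {s : ℝ} (hs : 0 ≤ s) :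
    ∫ z, ‖z‖ ^ s ∂(_root_.stdGaussian d) =
      2 ^ (s / 2) * Real.Gamma ((s + d) / 2) / Real.Gamma (d / 2) := by
  have : Nonempty (Fin d) := ⟨⟨0, hd⟩⟩
  obtain ⟨c, hc⟩ : ∃ c : ℝ, ∀ s : ℝ, 0 ≤ s → ∫ z, ‖z‖ ^ s ∂(_root_.stdGaussian d) =
      c * (2 ^ ((s + d) / 2) * 2⁻¹ * Real.Gamma ((s + d) / 2)) := by
    refine ⟨(Real.sqrt (2 * π))⁻¹ ^ d *
      (d * (volume : Measure (EuclideanSpace ℝ (Fin d))).real (Metric.ball 0 1)), fun s hs => ?_⟩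
    have := integral_fun_norm_addHaar (volume : Measure (EuclideanSpace ℝ (Fin d)))
      (fun y => y ^ s * Real.exp (-y ^ 2 / 2))
    simp only [finrank_euclideanSpace, Fintype.card_fin, smul_eq_mul, nsmul_eq_mul,
      (radial_integral hd hs).2] at this
    rw [integral_stdGaussian]
    simp only [stdGaussianDensity]
    rw [mul_assoc, mul_assoc, ← this, ← integral_const_mul]
    congr 1 with z
    ring
  have h0 := hc 0 le_rfl
  simp only [Real.rpow_zero, integral_const, probReal_univ, smul_eq_mul, mul_one, zero_add] at h0
  have hd0 : (0 : ℝ) < d / 2 := by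
    have : (1 : ℝ) ≤ d := by exact_mod_cast hd
    linarith
  have hG : Real.Gamma (d / 2) ≠ 0 := (Real.Gamma_pos_of_pos hd0).ne'
  rw [hc s hs, eq_div_iff hG, add_div, Real.rpow_add two_pos]
  linear_combination (-2 ^ (s / 2) * Real.Gamma (s / 2 + d / 2)) * h0

lemma integral_norm_rpow_add_two_stdGaussian {d : ℕ} (hd : 1 ≤ d) {s : ℝ} (hs : 0 ≤ s) :
    ∫ z, ‖z‖ ^ (s + 2) ∂(_root_.stdGaussian d) =
      (s + d) * (2 ^ (s / 2) * Real.Gamma ((s + d) / 2) / Real.Gamma (d / 2)) := by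
  have hd0 : (1 : ℝ) ≤ d := by exact_mod_cast hd
  rw [integral_norm_rpow_stdGaussian hd (by linarith), show (s + 2 + d) / 2 = (s + d) / 2 + 1 by
    ring, Real.Gamma_add_one (by linarith), add_div, Real.rpow_add two_pos]
  norm_num
  ring

lemma ContDiff.pderivI {d : ℕ} {f : EuclideanSpace ℝ (Fin d) → ℝ}
    (hf : ContDiff ℝ (⊤ : ℕ∞) f) (j : Fin d) : ContDiff ℝ (⊤ : ℕ∞) (_root_.pderivI j f) :=
  (hf.fderiv_right (m := (⊤ : ℕ∞)) (by simp)).clm_apply contDiff_const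

lemma HasCompactSupport.pderivI {d : ℕ} {f : EuclideanSpace ℝ (Fin d) → ℝ}
    (hf : HasCompactSupport f) (j : Fin d) : HasCompactSupport (_root_.pderivI j f) :=
  hf.fderiv_apply ℝ _

lemma ContDiff.pderivList {d : ℕ} {f : EuclideanSpace ℝ (Fin d) → ℝ}
    (hf : ContDiff ℝ (⊤ : ℕ∞) f) (l : List (Fin d)) :
    ContDiff ℝ (⊤ : ℕ∞) (_root_.pderivList l f) := by
  induction l with
  | nil => exact hf
  | cons j l ih => exact ih.pderivI j

lemma HasCompactSupport.pderivList {d : ℕ} {f : EuclideanSpace ℝ (Fin d) → ℝ}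
    (hf : HasCompactSupport f) (l : List (Fin d)) :
    HasCompactSupport (_root_.pderivList l f) := by
  induction l with
  | nil => exact hf
  | cons j l ih => exact ih.pderivI j

lemma pderivI_mul {d : ℕ} {f g : EuclideanSpace ℝ (Fin d) → ℝ}
    (hf : Differentiable ℝ f) (hg : Differentiable ℝ g) (j : Fin d)
    (z : EuclideanSpace ℝ (Fin d)) :
    pderivI j (fun z => f z * g z) z = pderivI j f z * g z + f z * pderivI j g z := by
  simp only [pderivI]
  rw [fderiv_fun_mul (hf z) (hg z)]
  simp only [_root_.add_apply, _root_.smul_apply, smul_eq_mul]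
  ring

lemma pderivI_coord {d : ℕ} (i j : Fin d) (z : EuclideanSpace ℝ (Fin d)) :
    pderivI j (fun z : EuclideanSpace ℝ (Fin d) => z i) z = if i = j then 1 else 0 := by
  have : HasFDerivAt (fun z : EuclideanSpace ℝ (Fin d) => z i)
      (EuclideanSpace.proj i : EuclideanSpace ℝ (Fin d) →L[ℝ] ℝ) z :=
    (EuclideanSpace.proj i : EuclideanSpace ℝ (Fin d) →L[ℝ] ℝ).hasFDerivAt
  simp [pderivI, this.fderiv]

lemma contDiff_coord {d : ℕ} (i : Fin d) :
    ContDiff ℝ (⊤ : ℕ∞) (fun z : EuclideanSpace ℝ (Fin d) => z i) :=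
  (EuclideanSpace.proj i : EuclideanSpace ℝ (Fin d) →L[ℝ] ℝ).contDiff

lemma pderivI_stdGaussianDensity {d : ℕ} (j : Fin d) (z : EuclideanSpace ℝ (Fin d)) :
    pderivI j (stdGaussianDensity d) z = -(z j * stdGaussianDensity d z) := by
  have h1 : HasFDerivAt (fun z : EuclideanSpace ℝ (Fin d) => ‖z‖ ^ 2) (2 • innerSL ℝ z) z :=
    (hasStrictFDerivAt_norm_sq z).hasFDerivAt
  have h2 := ((h1.neg.mul_const 2⁻¹).exp).const_mul ((Real.sqrt (2 * π))⁻¹ ^ d)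
  have h3 : stdGaussianDensity d =
      fun z => (Real.sqrt (2 * π))⁻¹ ^ d * Real.exp (-‖z‖ ^ 2 * 2⁻¹) := rfl
  rw [pderivI, show fderiv ℝ (stdGaussianDensity d) z = _ from
    (congrArg (fun f => fderiv ℝ f z) h3).trans h2.fderiv]
  simp [stdGaussianDensity, EuclideanSpace.inner_single_right]
  ring_nf

/-- Gaussian integration by parts against a smooth compactly supported function. -/
lemma integral_pderivI_mul_stdGaussian {d : ℕ} {G φ : EuclideanSpace ℝ (Fin d) → ℝ}
    (hG : ContDiff ℝ (⊤ : ℕ∞) G) (hGs : HasCompactSupport G) (hφ : ContDiff ℝ (⊤ : ℕ∞) φ)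
    (i : Fin d) :
    ∫ z, pderivI i G z * φ z ∂(_root_.stdGaussian d) =
      ∫ z, G z * (z i * φ z - pderivI i φ z) ∂(_root_.stdGaussian d) := by
  have hρ := contDiff_stdGaussianDensity d
  set f : EuclideanSpace ℝ (Fin d) → ℝ := fun z => φ z * stdGaussianDensity d z with hf
  have hfs : ContDiff ℝ (⊤ : ℕ∞) f := hφ.mul hρ
  have key := integral_mul_fderiv_eq_neg_fderiv_mul_of_integrable (𝕜 := ℝ)
    (μ := (volume : Measure (EuclideanSpace ℝ (Fin d))))
    (f := f) (g := G) (v := EuclideanSpace.single i 1)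
    (((hfs.pderivI i).continuous.mul hG.continuous).integrable_of_hasCompactSupport
      hGs.mul_left)
    ((hfs.continuous.mul (hG.pderivI i).continuous).integrable_of_hasCompactSupport
      (hGs.pderivI i).mul_left)
    ((hfs.continuous.mul hG.continuous).integrable_of_hasCompactSupport hGs.mul_left)
    (fun z _ => hfs.differentiable (by simp) z) (fun z _ => hG.differentiable (by simp) z)
  rw [integral_stdGaussian, integral_stdGaussian]
  calc _ = ∫ z, f z * fderiv ℝ G z (EuclideanSpace.single i 1) := by
        congr 1 with z
        simp only [hf, pderivI]; ring
    _ = -∫ z, fderiv ℝ f z (EuclideanSpace.single i 1) * G z := key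
    _ = _ := by
        rw [← integral_neg]
        congr 1 with z
        have := pderivI_mul (hφ.differentiable (by simp)) (hρ.differentiable (by simp)) i z
        rw [pderivI_stdGaussianDensity] at this
        rw [show fderiv ℝ f z (EuclideanSpace.single i 1) = _ from this]
        ring

/-- The second Hermite polynomial in the directions `i` and `j`. -/
noncomputable def hermiteTwo {d : ℕ} (i j : Fin d) (z : EuclideanSpace ℝ (Fin d)) : ℝ :=
  z i * z j - if i = j then 1 else 0

lemma continuous_hermiteTwo {d : ℕ} (i j : Fin d) : Continuous (hermiteTwo i j) :=
  ((contDiff_coord i).continuous.mul (contDiff_coord j).continuous).sub continuous_const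

lemma integral_pderivI_pderivI_stdGaussian {d : ℕ} {G : EuclideanSpace ℝ (Fin d) → ℝ}
    (hG : ContDiff ℝ (⊤ : ℕ∞) G) (hGs : HasCompactSupport G) (i j : Fin d) :
    ∫ z, pderivI i (pderivI j G) z ∂(_root_.stdGaussian d) =
      ∫ z, G z * hermiteTwo i j z ∂(_root_.stdGaussian d) := by
  have h1 := integral_pderivI_mul_stdGaussian (hG.pderivI j) (hGs.pderivI j)
    (contDiff_const (c := (1 : ℝ))) i
  have h2 := integral_pderivI_mul_stdGaussian hG hGs (contDiff_coord i) j
  simp only [pderivI_coord] at h2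
  have h0 : ∀ z : EuclideanSpace ℝ (Fin d), pderivI i (fun _ => (1 : ℝ)) z = 0 := fun z => by
    simp [pderivI]
  simp only [h0, mul_one, sub_zero] at h1
  rw [h1, h2]
  simp only [hermiteTwo, mul_comm]

lemma pderivI_comp_affine {d : ℕ} {g : EuclideanSpace ℝ (Fin d) → ℝ}
    (hg : Differentiable ℝ g) (a : EuclideanSpace ℝ (Fin d)) (s : ℝ) (j : Fin d) :
    pderivI j (fun z => g (a + s • z)) = fun z => s * pderivI j g (a + s • z) := by
  ext z
  have h1 : HasFDerivAt (fun z : EuclideanSpace ℝ (Fin d) => a + s • z)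
      (s • ContinuousLinearMap.id ℝ _) z := ((hasFDerivAt_id z).const_smul s).const_add a
  have h2 := (hg (a + s • z)).hasFDerivAt.comp z h1
  rw [pderivI, show fderiv ℝ (fun z => g (a + s • z)) z = _ from h2.fderiv]
  simp [pderivI]

lemma hasCompactSupport_comp_affine {d : ℕ} {g : EuclideanSpace ℝ (Fin d) → ℝ}
    (hg : HasCompactSupport g) (a : EuclideanSpace ℝ (Fin d)) {s : ℝ} (hs : s ≠ 0) :
    HasCompactSupport (fun z => g (a + s • z)) :=
  hg.comp_homeomorph ((Homeomorph.smulOfNeZero s hs).trans (Homeomorph.addLeft a))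

lemma sq_mul_integral_pderivI_pderivI {d : ℕ} {g : EuclideanSpace ℝ (Fin d) → ℝ}
    (hg : ContDiff ℝ (⊤ : ℕ∞) g) (hgs : HasCompactSupport g)
    (a : EuclideanSpace ℝ (Fin d)) {s : ℝ} (hs : s ≠ 0) (i j : Fin d) :
    s ^ 2 * ∫ z, pderivI i (pderivI j g) (a + s • z) ∂(_root_.stdGaussian d) =
      ∫ z, g (a + s • z) * hermiteTwo i j z ∂(_root_.stdGaussian d) := by
  have hG : ContDiff ℝ (⊤ : ℕ∞) (fun z => g (a + s • z)) :=
    hg.comp (contDiff_const.add (contDiff_id.const_smul s))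
  rw [← integral_pderivI_pderivI_stdGaussian hG (hasCompactSupport_comp_affine hgs a hs) i j,
    pderivI_comp_affine (hg.differentiable (by simp)), ← integral_const_mul]
  congr 1 with z
  have h1 := pderivI_comp_affine ((hg.pderivI j).differentiable (by simp)) a s i
  have h2 := pderivI_mul (differentiable_const s) (f := fun _ => s)
    (g := fun z => pderivI j g (a + s • z))
    (((hg.pderivI j).comp (contDiff_const.add (contDiff_id.const_smul s))).differentiable
      (by simp)) i z
  rw [h2, h1]
  simp [pderivI]
  ring

lemma abs_coord_le_norm {d : ℕ} (z : EuclideanSpace ℝ (Fin d)) (i : Fin d) : |z i| ≤ ‖z‖ := by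
  simpa using PiLp.norm_apply_le z i

lemma abs_coord_mul_coord_le {d : ℕ} (z : EuclideanSpace ℝ (Fin d)) (i j : Fin d) :
    |z i * z j| ≤ ‖z‖ ^ 2 := by
  rw [abs_mul, sq]
  exact mul_le_mul (abs_coord_le_norm z i) (abs_coord_le_norm z j) (abs_nonneg _) (norm_nonneg _)

lemma abs_hermiteTwo_le {d : ℕ} (z : EuclideanSpace ℝ (Fin d)) (i j : Fin d) :
    |hermiteTwo i j z| ≤ ‖z‖ ^ 2 + 1 := by
  refine (abs_sub _ _).trans (add_le_add (abs_coord_mul_coord_le z i j) ?_)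
  split_ifs <;> simp

lemma integrable_norm_sq_stdGaussian {d : ℕ} (hd : 1 ≤ d) :
    Integrable (fun z => ‖z‖ ^ 2) (_root_.stdGaussian d) := by
  simpa using integrable_norm_rpow_stdGaussian hd (zero_le_two)

lemma integrable_norm_stdGaussian {d : ℕ} (hd : 1 ≤ d) :
    Integrable (fun z => ‖z‖) (_root_.stdGaussian d) := by
  simpa using integrable_norm_rpow_stdGaussian hd (zero_le_one)

lemma integrable_hermiteTwo {d : ℕ} (hd : 1 ≤ d) (i j : Fin d) :
    Integrable (hermiteTwo i j) (_root_.stdGaussian d) :=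
  ((integrable_norm_sq_stdGaussian hd).add (integrable_const 1)).mono'
    (continuous_hermiteTwo i j).aestronglyMeasurable
    (ae_of_all _ fun z => abs_hermiteTwo_le z i j)

lemma integral_hermiteTwo {d : ℕ} (hd : 1 ≤ d) (i j : Fin d) :
    ∫ z, hermiteTwo i j z ∂(_root_.stdGaussian d) = 0 := by
  have hρ := contDiff_stdGaussianDensity d
  set g : EuclideanSpace ℝ (Fin d) → ℝ := fun z => z i * stdGaussianDensity d z with hg
  have hgs : ContDiff ℝ (⊤ : ℕ∞) g := (contDiff_coord i).mul hρ
  have hder : ∀ z, fderiv ℝ g z (EuclideanSpace.single j 1) =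
      -(hermiteTwo i j z * stdGaussianDensity d z) := by
    intro z
    have := pderivI_mul ((contDiff_coord i).differentiable (by simp))
      (hρ.differentiable (by simp)) j z
    rw [pderivI_stdGaussianDensity, pderivI_coord] at this
    rw [show fderiv ℝ g z (EuclideanSpace.single j 1) = _ from this, hermiteTwo]
    ring
  have hgi : Integrable g := (integrable_stdGaussian_iff d _).1
    ((integrable_norm_stdGaussian hd).mono' (contDiff_coord i).continuous.aestronglyMeasurable
      (ae_of_all _ fun z => abs_coord_le_norm z i))
  have key := integral_mul_fderiv_eq_neg_fderiv_mul_of_integrable (𝕜 := ℝ)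
    (μ := (volume : Measure (EuclideanSpace ℝ (Fin d))))
    (f := fun _ => 1) (g := g) (v := EuclideanSpace.single j 1) (by simp)
    (by
      simp only [hder, one_mul]
      exact ((integrable_stdGaussian_iff d _).1 (integrable_hermiteTwo hd i j)).neg)
    (by simpa using hgi)
    (fun z _ => differentiableAt_const _) (fun z _ => hgs.differentiable (by simp) z)
  rw [integral_stdGaussian]
  simpa [hder, integral_neg] using key

lemma integral_abs_hermiteTwo_le {d : ℕ} (hd : 1 ≤ d) (i j : Fin d) :
    ∫ z, |hermiteTwo i j z| ∂(_root_.stdGaussian d) ≤ 2 := by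
  have hb : ∀ z, |hermiteTwo i j z| ≤ (hermiteTwo i i z + hermiteTwo j j z) / 2 + 2 := by
    intro z
    refine (abs_sub _ _).trans ?_
    have h1 : |z i * z j| ≤ (z i * z i + z j * z j) / 2 := by
      rw [abs_le]
      constructor <;> nlinarith [sq_nonneg (z i - z j), sq_nonneg (z i + z j)]
    have h2 : |if i = j then (1 : ℝ) else 0| ≤ 1 := by split_ifs <;> simp
    simp only [hermiteTwo, if_true]
    linarith
  have hi := integrable_hermiteTwo hd i i
  have hj := integrable_hermiteTwo hd j j
  refine (integral_mono (integrable_hermiteTwo hd i j).abs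
    (((hi.add hj).div_const 2).add (integrable_const 2)) hb).trans ?_
  rw [integral_add' ((hi.add hj).div_const 2) (integrable_const 2), integral_div,
    integral_add' hi hj, integral_hermiteTwo hd, integral_hermiteTwo hd]
  simp

lemma integrable_norm_rpow_mul_abs_hermiteTwo {d : ℕ} (hd : 1 ≤ d) {α : ℝ} (hα : 0 < α)
    (i j : Fin d) :
    Integrable (fun z => ‖z‖ ^ α * |hermiteTwo i j z|) (_root_.stdGaussian d) ∧
    ∫ z, ‖z‖ ^ α * |hermiteTwo i j z| ∂(_root_.stdGaussian d) ≤
      (α + d + 1) * (2 ^ (α / 2) * Real.Gamma ((α + d) / 2) / Real.Gamma (d / 2)) := by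
  have hb : ∀ z : EuclideanSpace ℝ (Fin d),
      ‖z‖ ^ α * |hermiteTwo i j z| ≤ ‖z‖ ^ (α + 2) + ‖z‖ ^ α := by
    intro z
    rw [Real.rpow_add_of_nonneg (norm_nonneg z) hα.le zero_le_two, Real.rpow_two]
    have := mul_le_mul_of_nonneg_left (abs_hermiteTwo_le z i j)
      (Real.rpow_nonneg (norm_nonneg z) α)
    linarith
  have h1 := integrable_norm_rpow_stdGaussian hd (by linarith : 0 ≤ α + 2)
  have h2 := integrable_norm_rpow_stdGaussian hd hα.le
  have hint : Integrable (fun z => ‖z‖ ^ α * |hermiteTwo i j z|) (_root_.stdGaussian d) := by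
    refine (h1.add h2).mono' ?_ (ae_of_all _ fun z => ?_)
    · exact ((continuous_norm.rpow_const fun _ => Or.inr hα.le).mul
        (continuous_hermiteTwo i j).abs).aestronglyMeasurable
    · rw [Real.norm_of_nonneg (by positivity)]
      exact hb z
  refine ⟨hint, (integral_mono hint (h1.add h2) hb).trans ?_⟩
  simp only [Pi.add_apply]
  rw [integral_add h1 h2, integral_norm_rpow_add_two_stdGaussian hd hα.le,
    integral_norm_rpow_stdGaussian hd hα.le]
  exact le_of_eq (by ring)

/-- The product of Lebesgue measure on `(0, 1)` and the standard Gaussian measure. -/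
noncomputable def timeGaussian (d : ℕ) : Measure (ℝ × EuclideanSpace ℝ (Fin d)) :=
  (volume.restrict (Ioo (0 : ℝ) 1)).prod (_root_.stdGaussian d)

lemma ae_timeGaussian_mem (d : ℕ) : ∀ᵐ q ∂(timeGaussian d), q.1 ∈ Ioo (0 : ℝ) 1 :=
  Measure.quasiMeasurePreserving_fst.ae (ae_restrict_mem measurableSet_Ioo)

lemma integrableOn_rpow_Ioo {r : ℝ} (hr : -1 < r) :
    IntegrableOn (fun t : ℝ => t ^ r) (Ioo 0 1) :=
  (intervalIntegral.integrableOn_Ioo_rpow_iff one_pos).2 hr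

lemma integrableOn_inv_sqrt : IntegrableOn (fun t : ℝ => (Real.sqrt t)⁻¹) (Ioo 0 1) := by
  refine (integrableOn_congr_fun (fun t ht => ?_) measurableSet_Ioo).1
    (integrableOn_rpow_Ioo (r := -(1 / 2)) (by norm_num))
  rw [Real.rpow_neg ht.1.le, Real.sqrt_eq_rpow]

/-- The Ornstein–Uhlenbeck type interpolation `√t x + √(1-t) z`, with `q = (t, z)`. -/
noncomputable def ouPoint {d : ℕ} (x : EuclideanSpace ℝ (Fin d))
    (q : ℝ × EuclideanSpace ℝ (Fin d)) : EuclideanSpace ℝ (Fin d) :=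
  Real.sqrt q.1 • x + Real.sqrt (1 - q.1) • q.2

lemma continuous_ouPoint {d : ℕ} (x : EuclideanSpace ℝ (Fin d)) : Continuous (ouPoint x) := by
  unfold ouPoint; fun_prop

lemma weight_nonneg {t : ℝ} (ht : t ∈ Ioo (0 : ℝ) 1) (k : ℕ) :
    0 ≤ 1 / (2 * t) * Real.sqrt t ^ k := by
  have := ht.1
  positivity

lemma weight_le {t : ℝ} (ht : t ∈ Ioo (0 : ℝ) 1) (k : ℕ) :
    1 / (2 * t) * Real.sqrt t ^ (k + 1) ≤ (Real.sqrt t)⁻¹ := by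
  have h0 := Real.sqrt_pos.2 ht.1
  have h1 : Real.sqrt t ≤ 1 := Real.sqrt_le_one.2 ht.2.le
  have h2 : Real.sqrt t ^ k ≤ 1 := pow_le_one₀ h0.le h1
  have h3 : 1 / (2 * t) * Real.sqrt t ^ (k + 1) = (Real.sqrt t)⁻¹ * (Real.sqrt t ^ k / 2) := by
    have : t = Real.sqrt t * Real.sqrt t := (Real.mul_self_sqrt ht.1.le).symm
    rw [pow_succ]
    nth_rw 1 [this]
    field_simp
  rw [h3]
  exact mul_le_of_le_one_right (inv_nonneg.2 h0.le) (by linarith)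

lemma integrable_weight_mul {d : ℕ} {G : EuclideanSpace ℝ (Fin d) → ℝ}
    (hG : Continuous G) (hGs : HasCompactSupport G) (k : ℕ) (x : EuclideanSpace ℝ (Fin d)) :
    Integrable (fun q => 1 / (2 * q.1) * (Real.sqrt q.1 ^ (k + 1) * G (ouPoint x q)))
      (timeGaussian d) := by
  obtain ⟨C, hC⟩ := hGs.exists_bound_of_continuous hG
  refine ((integrableOn_inv_sqrt.comp_fst (_root_.stdGaussian d)).mul_const C).mono' ?_ ?_
  · exact (Measurable.mul (by fun_prop) (Measurable.mul (by fun_prop)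
      (hG.comp (continuous_ouPoint x)).measurable)).aestronglyMeasurable
  · filter_upwards [ae_timeGaussian_mem d] with q hq
    rw [← mul_assoc, norm_mul, Real.norm_of_nonneg (weight_nonneg hq _)]
    exact mul_le_mul (weight_le hq k) (hC _) (norm_nonneg _) (inv_nonneg.2 (Real.sqrt_nonneg _))

/-- Differentiation under the integral sign for weighted averages of `G (√t x + √(1-t) z)`. -/
lemma pderivI_integral_weight_mul {d : ℕ} {G : EuclideanSpace ℝ (Fin d) → ℝ}
    (hG : ContDiff ℝ (⊤ : ℕ∞) G) (hGs : HasCompactSupport G) (k : ℕ)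
    (c : ℝ × EuclideanSpace ℝ (Fin d) → ℝ)
    (hint : ∀ x, Integrable (fun q => 1 / (2 * q.1) *
      (Real.sqrt q.1 ^ k * G (ouPoint x q) - c q)) (timeGaussian d)) (j : Fin d) :
    pderivI j (fun x => ∫ q, 1 / (2 * q.1) *
      (Real.sqrt q.1 ^ k * G (ouPoint x q) - c q) ∂(timeGaussian d)) =
    fun x => ∫ q, 1 / (2 * q.1) *
      (Real.sqrt q.1 ^ (k + 1) * pderivI j G (ouPoint x q)) ∂(timeGaussian d) := by
  ext x
  have hG' : Continuous (fderiv ℝ G) := hG.continuous_fderiv (by simp)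
  obtain ⟨C, hC⟩ := (hGs.fderiv ℝ).exists_bound_of_continuous hG'
  set F' : EuclideanSpace ℝ (Fin d) → ℝ × EuclideanSpace ℝ (Fin d) →
      EuclideanSpace ℝ (Fin d) →L[ℝ] ℝ := fun x q =>
    (1 / (2 * q.1) * Real.sqrt q.1 ^ (k + 1)) • fderiv ℝ G (ouPoint x q) with hF'
  have hmeas : AEStronglyMeasurable (F' x) (timeGaussian d) :=
    (show Measurable fun q : ℝ × EuclideanSpace ℝ (Fin d) =>
      1 / (2 * q.1) * Real.sqrt q.1 ^ (k + 1) by fun_prop).aestronglyMeasurable.smul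
      (hG'.comp (continuous_ouPoint x)).aestronglyMeasurable
  have hbound : ∀ᵐ q ∂(timeGaussian d), ∀ x ∈ (Set.univ : Set (EuclideanSpace ℝ (Fin d))),
      ‖F' x q‖ ≤ (Real.sqrt q.1)⁻¹ * C := by
    filter_upwards [ae_timeGaussian_mem d] with q hq x _
    rw [hF', norm_smul, Real.norm_of_nonneg (weight_nonneg hq _)]
    exact mul_le_mul (weight_le hq k) (hC _) (norm_nonneg _) (inv_nonneg.2 (Real.sqrt_nonneg _))
  have hbi : Integrable (fun q : ℝ × EuclideanSpace ℝ (Fin d) => (Real.sqrt q.1)⁻¹ * C)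
      (timeGaussian d) := (integrableOn_inv_sqrt.comp_fst (_root_.stdGaussian d)).mul_const C
  have hdiff : ∀ q x, HasFDerivAt (fun x => 1 / (2 * q.1) *
      (Real.sqrt q.1 ^ k * G (ouPoint x q) - c q)) (F' x q) x := by
    intro q x
    have h1 : HasFDerivAt (fun x : EuclideanSpace ℝ (Fin d) => ouPoint x q)
        (Real.sqrt q.1 • ContinuousLinearMap.id ℝ _) x :=
      ((hasFDerivAt_id x).const_smul (Real.sqrt q.1)).add_const (Real.sqrt (1 - q.1) • q.2)
    have h2 := (hG.differentiable (by simp) (ouPoint x q)).hasFDerivAt.comp x h1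
    have h3 := ((h2.const_mul (Real.sqrt q.1 ^ k)).sub_const (c q)).const_mul (1 / (2 * q.1))
    refine h3.congr_fderiv ?_
    ext v
    simp [hF', pow_succ]
    ring
  have key := hasFDerivAt_integral_of_dominated_of_fderiv_le (μ := timeGaussian d) (x₀ := x)
    (F := fun x q => 1 / (2 * q.1) * (Real.sqrt q.1 ^ k * G (ouPoint x q) - c q)) (F' := F')
    (s := Set.univ) Filter.univ_mem (.of_forall fun x => (hint x).aestronglyMeasurable) (hint x)
    hmeas hbound hbi (ae_of_all _ fun q x _ => hdiff q x)
  rw [pderivI, key.fderiv, ContinuousLinearMap.integral_apply]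
  · congr 1 with q
    simp only [hF', pderivI, _root_.smul_apply, smul_eq_mul]
    ring
  · exact hbi.mono' hmeas (hbound.mono fun q hq => hq x trivial)

lemma one_sub_sqrt_one_sub_le {t : ℝ} (ht : t ∈ Ioo (0 : ℝ) 1) :
    |Real.sqrt (1 - t) - 1| ≤ Real.sqrt t := by
  have h1 : Real.sqrt (1 - t) ≤ 1 := Real.sqrt_le_one.2 (by linarith [ht.1])
  have h0 := Real.sqrt_nonneg t
  have h2 := Real.sqrt_nonneg (1 - t)
  have h3 := Real.sq_sqrt ht.1.le
  have h4 := Real.sq_sqrt (show 0 ≤ 1 - t by linarith [ht.2])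
  rw [abs_of_nonpos (by linarith)]
  nlinarith

lemma integrable_steinSol_integrand {d : ℕ} (hd : 1 ≤ d) {h : EuclideanSpace ℝ (Fin d) → ℝ}
    (hh : ContDiff ℝ (⊤ : ℕ∞) h) (hhs : HasCompactSupport h) (x : EuclideanSpace ℝ (Fin d)) :
    Integrable (fun q => 1 / (2 * q.1) * (Real.sqrt q.1 ^ 0 * h (ouPoint x q) - h q.2))
      (timeGaussian d) := by
  obtain ⟨C, hC⟩ := ContDiff.lipschitzWith_of_hasCompactSupport hhs hh (by simp)
  have hz : Integrable (fun z => (C : ℝ) * (‖x‖ + ‖z‖)) (_root_.stdGaussian d) :=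
    ((integrable_const _).add (integrable_norm_stdGaussian hd)).const_mul _
  refine (Integrable.mul_prod integrableOn_inv_sqrt hz).mono' ?_ ?_
  · exact (Measurable.mul (by fun_prop) (((measurable_fst.sqrt.pow_const 0).mul
      (hh.continuous.comp (continuous_ouPoint x)).measurable).sub
      (hh.continuous.comp continuous_snd).measurable)).aestronglyMeasurable
  · filter_upwards [ae_timeGaussian_mem d] with q hq
    have h1 := hC.dist_le_mul (ouPoint x q) q.2
    have h2 : dist (ouPoint x q) q.2 ≤ Real.sqrt q.1 * (‖x‖ + ‖q.2‖) := by
      rw [dist_eq_norm, show ouPoint x q - q.2 =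
        Real.sqrt q.1 • x + (Real.sqrt (1 - q.1) - 1) • q.2 by unfold ouPoint; module]
      refine (norm_add_le _ _).trans ?_
      rw [norm_smul, norm_smul, Real.norm_of_nonneg (Real.sqrt_nonneg _), mul_add]
      gcongr
      exact one_sub_sqrt_one_sub_le hq
    have h3 : |Real.sqrt q.1 ^ 0 * h (ouPoint x q) - h q.2| ≤
        Real.sqrt q.1 * ((C : ℝ) * (‖x‖ + ‖q.2‖)) := by
      rw [pow_zero, one_mul, ← Real.dist_eq]
      calc _ ≤ _ := h1
        _ ≤ C * (Real.sqrt q.1 * (‖x‖ + ‖q.2‖)) := by gcongr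
        _ = _ := by ring
    have hw : 0 ≤ 1 / (2 * q.1) := by simpa using weight_nonneg hq 0
    rw [norm_mul, Real.norm_of_nonneg hw, Real.norm_eq_abs]
    calc _ ≤ 1 / (2 * q.1) * (Real.sqrt q.1 * ((C : ℝ) * (‖x‖ + ‖q.2‖))) := by gcongr
      _ = (1 / (2 * q.1) * Real.sqrt q.1 ^ (0 + 1)) * ((C : ℝ) * (‖x‖ + ‖q.2‖)) := by ring
      _ ≤ _ := by gcongr; exact weight_le hq 0

lemma integrable_stdGaussian_of_hasCompactSupport {d : ℕ} {G : EuclideanSpace ℝ (Fin d) → ℝ}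
    (hG : Continuous G) (hGs : HasCompactSupport G)
    {u : EuclideanSpace ℝ (Fin d) → EuclideanSpace ℝ (Fin d)} (hu : Continuous u) :
    Integrable (fun z => G (u z)) (_root_.stdGaussian d) := by
  obtain ⟨C, hC⟩ := hGs.exists_bound_of_continuous hG
  exact (integrable_const C).mono' (hG.comp hu).aestronglyMeasurable (ae_of_all _ fun z => hC _)

lemma steinSol_eq_integral {d : ℕ} (hd : 1 ≤ d) {h : EuclideanSpace ℝ (Fin d) → ℝ}
    (hh : ContDiff ℝ (⊤ : ℕ∞) h) (hhs : HasCompactSupport h) :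
    steinSol d h = fun x => -∫ q, 1 / (2 * q.1) *
      (Real.sqrt q.1 ^ 0 * h (ouPoint x q) - h q.2) ∂(timeGaussian d) := by
  ext x
  rw [steinSol, timeGaussian, integral_prod _ (integrable_steinSol_integrand hd hh hhs x)]
  congr 1
  refine integral_congr_ae (ae_of_all _ fun t => ?_)
  simp only [hbar, ouPoint, pow_zero, one_mul]
  have h1 : Integrable (fun z => h (Real.sqrt t • x + Real.sqrt (1 - t) • z))
      (_root_.stdGaussian d) :=
    integrable_stdGaussian_of_hasCompactSupport hh.continuous hhs (by fun_prop)
  have h2 : Integrable (fun z => h z) (_root_.stdGaussian d) :=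
    integrable_stdGaussian_of_hasCompactSupport hh.continuous hhs continuous_id
  rw [integral_const_mul, integral_sub h1 h2, integral_sub h1 (integrable_const _)]
  simp

lemma pderivI_neg {d : ℕ} (j : Fin d) (f : EuclideanSpace ℝ (Fin d) → ℝ) :
    pderivI j (fun x => -f x) = fun x => -pderivI j f x := by
  ext x
  simp [pderivI, fderiv_fun_neg]

lemma pderivList_steinSol {d : ℕ} (hd : 1 ≤ d) {h : EuclideanSpace ℝ (Fin d) → ℝ}
    (hh : ContDiff ℝ (⊤ : ℕ∞) h) (hhs : HasCompactSupport h) (l : List (Fin d)) (j : Fin d) :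
    pderivList (j :: l) (steinSol d h) = fun x => -∫ q, 1 / (2 * q.1) *
      (Real.sqrt q.1 ^ (l.length + 1) * pderivList (j :: l) h (ouPoint x q))
        ∂(timeGaussian d) := by
  induction l generalizing j with
  | nil =>
    simp only [pderivList]
    rw [steinSol_eq_integral hd hh hhs, pderivI_neg, pderivI_integral_weight_mul hh hhs 0
      (fun q => h q.2) (integrable_steinSol_integrand hd hh hhs)]
    rfl
  | cons i l ih =>
    rw [pderivList, ih i, pderivI_neg]
    have hG := hh.pderivList (i :: l)
    have hGs := hhs.pderivList (i :: l)
    have := pderivI_integral_weight_mul hG hGs (l.length + 1) (fun _ => 0) (fun x => by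
      simpa only [sub_zero] using integrable_weight_mul hG.continuous hGs l.length x) j
    simp only [sub_zero] at this
    rw [this]
    rfl

section HolderEstimates

variable {d : ℕ} {g : EuclideanSpace ℝ (Fin d) → ℝ} {α L : ℝ}

/-- The difference of Gaussian averages of a second derivative, after two integrations by parts. -/
lemma sq_mul_integral_sub_integral (hg : ContDiff ℝ (⊤ : ℕ∞) g) (hgs : HasCompactSupport g)
    (hd : 1 ≤ d) (a b : EuclideanSpace ℝ (Fin d)) {s : ℝ} (hs : 0 < s) (i j : Fin d) (c : ℝ) :
    s ^ 2 * ((∫ z, pderivI i (pderivI j g) (a + s • z) ∂(_root_.stdGaussian d)) -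
      ∫ z, pderivI i (pderivI j g) (b + s • z) ∂(_root_.stdGaussian d)) =
      ∫ z, (g (a + s • z) - g (b + s • z) - c) * hermiteTwo i j z ∂(_root_.stdGaussian d) := by
  have hi : ∀ a, Integrable (fun z => g (a + s • z) * hermiteTwo i j z)
      (_root_.stdGaussian d) := by
    intro a
    obtain ⟨C, hC⟩ := hgs.exists_bound_of_continuous hg.continuous
    exact (integrable_hermiteTwo hd i j).bdd_mul
      (hg.continuous.comp (by fun_prop)).aestronglyMeasurable (ae_of_all _ fun z => hC (a + s • z))
  have hab : Integrable (fun z => g (a + s • z) * hermiteTwo i j z -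
      g (b + s • z) * hermiteTwo i j z) (_root_.stdGaussian d) := (hi a).sub (hi b)
  simp only [sub_mul]
  rw [integral_sub hab ((integrable_hermiteTwo hd i j).const_mul c),
    integral_sub (hi a) (hi b), integral_const_mul, integral_hermiteTwo hd, mul_sub,
    sq_mul_integral_pderivI_pderivI hg hgs a hs.ne',
    sq_mul_integral_pderivI_pderivI hg hgs b hs.ne']
  ring

lemma sq_mul_abs_integral_sub_le_dist (hg : ContDiff ℝ (⊤ : ℕ∞) g) (hgs : HasCompactSupport g)
    (hd : 1 ≤ d) (hL : 0 ≤ L) (hgL : ∀ x y, |g x - g y| ≤ L * dist x y ^ α)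
    (a b : EuclideanSpace ℝ (Fin d)) {s : ℝ} (hs : 0 < s) (i j : Fin d) :
    s ^ 2 * |(∫ z, pderivI i (pderivI j g) (a + s • z) ∂(_root_.stdGaussian d)) -
      ∫ z, pderivI i (pderivI j g) (b + s • z) ∂(_root_.stdGaussian d)| ≤
      2 * L * dist a b ^ α := by
  rw [← abs_of_nonneg (sq_nonneg s), ← abs_mul,
    sq_mul_integral_sub_integral hg hgs hd a b hs i j 0]
  have hb : ∀ z, ‖(g (a + s • z) - g (b + s • z) - 0) * hermiteTwo i j z‖ ≤
      L * dist a b ^ α * |hermiteTwo i j z| := by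
    intro z
    rw [norm_mul, sub_zero]
    refine mul_le_mul_of_nonneg_right ?_ (norm_nonneg _)
    simpa using hgL (a + s • z) (b + s • z)
  refine (norm_integral_le_of_norm_le ((integrable_hermiteTwo hd i j).abs.const_mul _)
    (ae_of_all _ hb)).trans ?_
  rw [integral_const_mul]
  have := mul_le_mul_of_nonneg_left (integral_abs_hermiteTwo_le hd i j)
    (by positivity : 0 ≤ L * dist a b ^ α)
  linarith

lemma sq_mul_abs_integral_sub_le_rpow (hg : ContDiff ℝ (⊤ : ℕ∞) g) (hgs : HasCompactSupport g)
    (hd : 1 ≤ d) (hα : 0 < α) (hL : 0 ≤ L) (hgL : ∀ x y, |g x - g y| ≤ L * dist x y ^ α)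
    (a b : EuclideanSpace ℝ (Fin d)) {s : ℝ} (hs : 0 < s) (i j : Fin d) :
    s ^ 2 * |(∫ z, pderivI i (pderivI j g) (a + s • z) ∂(_root_.stdGaussian d)) -
      ∫ z, pderivI i (pderivI j g) (b + s • z) ∂(_root_.stdGaussian d)| ≤
      2 * L * s ^ α *
        ((α + d + 1) * (2 ^ (α / 2) * Real.Gamma ((α + d) / 2) / Real.Gamma (d / 2))) := by
  rw [← abs_of_nonneg (sq_nonneg s), ← abs_mul,
    sq_mul_integral_sub_integral hg hgs hd a b hs i j (g a - g b)]
  obtain ⟨hint, hle⟩ := integrable_norm_rpow_mul_abs_hermiteTwo hd hα i j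
  have h1 : ∀ a z, |g (a + s • z) - g a| ≤ L * (s ^ α * ‖z‖ ^ α) := by
    intro a z
    refine (hgL _ _).trans_eq ?_
    rw [dist_self_add_left, norm_smul, Real.norm_of_nonneg hs.le,
      Real.mul_rpow hs.le (norm_nonneg z)]
  have hb : ∀ z, ‖(g (a + s • z) - g (b + s • z) - (g a - g b)) * hermiteTwo i j z‖ ≤
      2 * L * s ^ α * (‖z‖ ^ α * |hermiteTwo i j z|) := by
    intro z
    rw [norm_mul, ← mul_assoc]
    refine mul_le_mul_of_nonneg_right ?_ (norm_nonneg _)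
    rw [Real.norm_eq_abs, show g (a + s • z) - g (b + s • z) - (g a - g b) =
      (g (a + s • z) - g a) - (g (b + s • z) - g b) by ring]
    refine (abs_sub _ _).trans ?_
    linarith [h1 a z, h1 b z]
  refine (norm_integral_le_of_norm_le (hint.const_mul _) (ae_of_all _ hb)).trans ?_
  rw [integral_const_mul]
  exact mul_le_mul_of_nonneg_left hle (by positivity)

end HolderEstimates

lemma integral_rpow_sub_one_Ioo {r m : ℝ} (hr : 0 < r) (hm : 0 ≤ m) :
    ∫ u in Ioo (0 : ℝ) m, u ^ (r - 1) = m ^ r / r := by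
  rw [← integral_Ioc_eq_integral_Ioo, ← intervalIntegral.integral_of_le hm,
    integral_rpow (Or.inl (by linarith)), sub_add_cancel, Real.zero_rpow hr.ne', sub_zero]

lemma measurePreserving_one_sub_Ioo :
    MeasurePreserving (fun t : ℝ => 1 - t) (volume.restrict (Ioo 0 1))
      (volume.restrict (Ioo 0 1)) := by
  have h := (Measure.measurePreserving_sub_left (volume : Measure ℝ) 1).restrict_preimage
    (measurableSet_Ioo (a := (0 : ℝ)) (b := 1))
  simpa using h

/-- The dominating function for the time integrand after the change of variables `u = 1 - t`,
where `r` is the distance between the two points and `M` the moment constant. -/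
noncomputable def timeBound (α β M r u : ℝ) : ℝ :=
  (Ioo 0 (min 1 (r ^ 2))).indicator (fun u => M * u ^ (α / 2 - 1)) u +
    r ^ β * u ^ ((α - β) / 2 - 1)

section TimeBound

variable {α β M r : ℝ}

lemma le_timeBound (hβ : β ∈ Ioo 0 α) (hr : 0 ≤ r) {u e : ℝ}
    (hu : u ∈ Ioo (0 : ℝ) 1) (h1 : u * e ≤ M * u ^ (α / 2)) (h2 : u * e ≤ r ^ α) :
    e ≤ timeBound α β M r u := by
  have hu0 := hu.1
  by_cases hum : u < min 1 (r ^ 2)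
  · rw [timeBound, Set.indicator_of_mem (show u ∈ Ioo 0 (min 1 (r ^ 2)) from ⟨hu0, hum⟩)]
    refine le_add_of_le_of_nonneg ?_ (by positivity)
    rw [Real.rpow_sub_one hu0.ne', ← mul_div_assoc, le_div_iff₀ hu0]
    linarith
  · have hru : r ^ 2 ≤ u := by
      rcases min_le_iff.1 (not_lt.1 hum) with h | h
      · exact absurd hu.2 (not_lt.2 h)
      · exact h
    rw [timeBound, Set.indicator_of_notMem (fun h => hum h.2), zero_add,
      Real.rpow_sub_one hu0.ne', ← mul_div_assoc, le_div_iff₀ hu0, mul_comm e]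
    refine h2.trans ?_
    have hαβ : 0 ≤ α - β := by linarith [hβ.2]
    rw [show r ^ α = r ^ β * r ^ (α - β) by
      rw [← Real.rpow_add_of_nonneg hr hβ.1.le hαβ]; ring_nf]
    gcongr
    calc r ^ (α - β) = (r ^ 2) ^ ((α - β) / 2) := by
          rw [← Real.rpow_two, ← Real.rpow_mul hr]; ring_nf
      _ ≤ u ^ ((α - β) / 2) := Real.rpow_le_rpow (sq_nonneg r) hru (by linarith)

lemma integrableOn_timeBound (hβ : β ∈ Ioo 0 α) :
    IntegrableOn (timeBound α β M r) (Ioo 0 1) :=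
  (((integrableOn_rpow_Ioo (by linarith [hβ.1, hβ.2])).const_mul M).indicator
    measurableSet_Ioo).add ((integrableOn_rpow_Ioo (by linarith [hβ.2])).const_mul _)

lemma integral_timeBound_le (hβ : β ∈ Ioo 0 α) (hM : 0 ≤ M) (hr : 0 ≤ r) :
    ∫ u in Ioo (0 : ℝ) 1, timeBound α β M r u ≤ (M * (2 / α) + 2 / (α - β)) * r ^ β := by
  have hα : 0 < α := hβ.1.trans hβ.2
  have hm0 : 0 ≤ min 1 (r ^ 2) := le_min zero_le_one (sq_nonneg r)
  have hmr : min 1 (r ^ 2) ^ (α / 2) ≤ r ^ β :=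
    calc min 1 (r ^ 2) ^ (α / 2) ≤ min 1 (r ^ 2) ^ (β / 2) :=
          Real.rpow_le_rpow_of_exponent_ge' hm0 (min_le_left _ _) (by linarith [hβ.1])
            (by linarith [hβ.2])
      _ ≤ (r ^ 2) ^ (β / 2) :=
          Real.rpow_le_rpow hm0 (min_le_right _ _) (by linarith [hβ.1])
      _ = r ^ β := by rw [← Real.rpow_two, ← Real.rpow_mul hr]; ring_nf
  have h1 := ((integrableOn_rpow_Ioo (r := α / 2 - 1) (by linarith)).const_mul M).indicator
    (measurableSet_Ioo (a := (0 : ℝ)) (b := min 1 (r ^ 2)))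
  have h2 := (integrableOn_rpow_Ioo (r := (α - β) / 2 - 1) (by linarith [hβ.2])).const_mul (r ^ β)
  simp only [timeBound]
  rw [integral_add h1 h2, setIntegral_indicator measurableSet_Ioo, Set.Ioo_inter_Ioo,
    max_self, ← min_assoc, min_self, integral_const_mul, integral_const_mul,
    integral_rpow_sub_one_Ioo (by linarith) hm0,
    integral_rpow_sub_one_Ioo (by linarith [hβ.2]) zero_le_one, Real.one_rpow]
  have h3 := mul_le_mul_of_nonneg_left hmr (by positivity : 0 ≤ M * (2 / α))
  have h4 : M * (min 1 (r ^ 2) ^ (α / 2) / (α / 2)) =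
      M * (2 / α) * min 1 (r ^ 2) ^ (α / 2) := by field_simp
  rw [h4, one_div_div]
  linarith

end TimeBound

lemma weight_add_two_le_half {t : ℝ} (ht : t ∈ Ioo (0 : ℝ) 1) (k : ℕ) :
    1 / (2 * t) * Real.sqrt t ^ (k + 2) ≤ 1 / 2 := by
  have h0 := Real.sqrt_nonneg t
  have h2 : Real.sqrt t ^ k ≤ 1 := pow_le_one₀ h0 (Real.sqrt_le_one.2 ht.2.le)
  have ht0 := ht.1
  rw [pow_add, Real.sq_sqrt ht0.le]
  calc 1 / (2 * t) * (Real.sqrt t ^ k * t) = Real.sqrt t ^ k / 2 := by field_simp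
    _ ≤ 1 / 2 := by linarith

/-- The difference of weighted time averages of second derivatives of a Hölder function. -/
lemma abs_integral_weight_mul_sub_le {d : ℕ} (hd : 1 ≤ d) {α β L : ℝ} (hβ : β ∈ Ioo 0 α)
    (hL : 0 ≤ L) {g : EuclideanSpace ℝ (Fin d) → ℝ}
    (hg : ContDiff ℝ (⊤ : ℕ∞) g) (hgs : HasCompactSupport g)
    (hgL : ∀ x y, |g x - g y| ≤ L * dist x y ^ α) (k : ℕ) (i j : Fin d)
    (x y : EuclideanSpace ℝ (Fin d)) :
    |(∫ q, 1 / (2 * q.1) * (Real.sqrt q.1 ^ (k + 2) * pderivI i (pderivI j g) (ouPoint x q))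
        ∂(timeGaussian d)) -
      ∫ q, 1 / (2 * q.1) * (Real.sqrt q.1 ^ (k + 2) * pderivI i (pderivI j g) (ouPoint y q))
        ∂(timeGaussian d)| ≤
      L * (((α + d + 1) * (2 ^ (α / 2) * Real.Gamma ((α + d) / 2) / Real.Gamma (d / 2))) *
        (2 / α) + 2 / (α - β)) * dist x y ^ β := by
  have hα : 0 < α := hβ.1.trans hβ.2
  have hd0 : (1 : ℝ) ≤ d := by exact_mod_cast hd
  set M := (α + d + 1) * (2 ^ (α / 2) * Real.Gamma ((α + d) / 2) / Real.Gamma (d / 2)) with hMdef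
  have hM : 0 ≤ M := by
    have h1 := Real.Gamma_pos_of_pos (show (0 : ℝ) < d / 2 by linarith)
    have h2 := Real.Gamma_pos_of_pos (show (0 : ℝ) < (α + d) / 2 by linarith)
    positivity
  have hG := ((hg.pderivI j).pderivI i).continuous
  have hGs := (hgs.pderivI j).pderivI i
  have hi := fun x => integrable_weight_mul hG hGs (k + 1) x
  have hT := integrableOn_timeBound (M := M) (r := dist x y) hβ
  rw [timeGaussian] at hi ⊢
  rw [integral_prod _ (hi x), integral_prod _ (hi y),
    ← integral_sub (hi x).integral_prod_left (hi y).integral_prod_left]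
  have hbound : ∀ t ∈ Ioo (0 : ℝ) 1,
      ‖(∫ z, 1 / (2 * t) * (Real.sqrt t ^ (k + 2) * pderivI i (pderivI j g) (ouPoint x (t, z)))
          ∂(_root_.stdGaussian d)) -
        ∫ z, 1 / (2 * t) * (Real.sqrt t ^ (k + 2) * pderivI i (pderivI j g) (ouPoint y (t, z)))
          ∂(_root_.stdGaussian d)‖ ≤ L * timeBound α β M (dist x y) (1 - t) := by
    intro t ht
    have hu : 1 - t ∈ Ioo (0 : ℝ) 1 := ⟨by linarith [ht.2], by linarith [ht.1]⟩
    have hs : 0 < Real.sqrt (1 - t) := Real.sqrt_pos.2 hu.1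
    have hs2 : Real.sqrt (1 - t) ^ 2 = 1 - t := Real.sq_sqrt hu.1.le
    have hsα : Real.sqrt (1 - t) ^ α = (1 - t) ^ (α / 2) := by
      rw [Real.sqrt_eq_rpow, ← Real.rpow_mul hu.1.le]; ring_nf
    simp only [← mul_assoc, integral_const_mul, ouPoint]
    rw [← mul_sub, norm_mul, Real.norm_of_nonneg (weight_nonneg ht _), Real.norm_eq_abs]
    have hA := sq_mul_abs_integral_sub_le_rpow hg hgs hd hα hL hgL
      (Real.sqrt t • x) (Real.sqrt t • y) hs i j
    have hB := sq_mul_abs_integral_sub_le_dist hg hgs hd hL hgL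
      (Real.sqrt t • x) (Real.sqrt t • y) hs i j
    rw [hs2] at hA hB
    rw [hsα, ← hMdef] at hA
    set e := |(∫ z, pderivI i (pderivI j g) (Real.sqrt t • x + Real.sqrt (1 - t) • z)
        ∂(_root_.stdGaussian d)) -
      ∫ z, pderivI i (pderivI j g) (Real.sqrt t • y + Real.sqrt (1 - t) • z)
        ∂(_root_.stdGaussian d)|
    have hdist : dist (Real.sqrt t • x) (Real.sqrt t • y) ^ α ≤ dist x y ^ α := by
      refine Real.rpow_le_rpow dist_nonneg ?_ hα.le
      rw [dist_smul₀, Real.norm_of_nonneg (Real.sqrt_nonneg t)]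
      exact mul_le_of_le_one_left dist_nonneg (Real.sqrt_le_one.2 ht.2.le)
    have hB' := hB.trans (mul_le_mul_of_nonneg_left hdist (by positivity : 0 ≤ 2 * L))
    have he : 0 ≤ e := abs_nonneg _
    refine (mul_le_mul_of_nonneg_right (weight_add_two_le_half ht k) he).trans ?_
    rcases hL.eq_or_lt with rfl | hLpos
    · have : (1 - t) * e ≤ 0 := by simpa using hB'
      have : e ≤ 0 := nonpos_of_mul_nonpos_right this hu.1
      linarith
    · have := le_timeBound (β := β) (M := M) (e := e / (2 * L)) hβ dist_nonneg hu
        (by rw [← mul_div_assoc, div_le_iff₀ (by positivity)]; linarith)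
        (by rw [← mul_div_assoc, div_le_iff₀ (by positivity)]; linarith)
      rw [div_le_iff₀ (by positivity)] at this
      linarith
  have hmp := measurePreserving_one_sub_Ioo
  have hme : MeasurableEmbedding (fun t : ℝ => 1 - t) :=
    (MeasurableEquiv.subLeft 1).measurableEmbedding
  have hint : IntegrableOn (fun t => L * timeBound α β M (dist x y) (1 - t)) (Ioo 0 1) :=
    (hmp.integrable_comp_of_integrable hT).const_mul L
  refine (norm_integral_le_of_norm_le hint
    ((ae_restrict_iff' measurableSet_Ioo).2 (ae_of_all _ hbound))).trans ?_
  rw [integral_const_mul, hmp.integral_comp hme, mul_assoc]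
  exact mul_le_mul_of_nonneg_left (integral_timeBound_le hβ hM dist_nonneg) hL

/-- **Proposition 4.1, second part**: all derivatives of order `p + 2` of Barbour's solution
are `β`-Hölder for every `0 < β < α`, when all derivatives of order `p` of `h` are `α`-Hölder
with common constant `L`. -/
theorem steinSol_higher_deriv_beta_holder
    {d : ℕ} (hd : 1 ≤ d) {α : ℝ} (hα : α ∈ Set.Ioc (0 : ℝ) 1) (p : ℕ)
    (h : EuclideanSpace ℝ (Fin d) → ℝ)
    (hsmooth : ContDiff ℝ (⊤ : ℕ∞) h) (hsupp : HasCompactSupport h)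
    {L : ℝ} (hL0 : 0 ≤ L)
    (hL : ∀ ι : Fin p → Fin d, ∀ x y,
      |pderivList (List.ofFn ι) h x - pderivList (List.ofFn ι) h y| ≤ L * dist x y ^ α) :
    ∀ β ∈ Set.Ioo (0 : ℝ) α, ∀ ι : Fin (p + 2) → Fin d, ∀ x y : EuclideanSpace ℝ (Fin d),
      |pderivList (List.ofFn ι) (steinSol d h) x -
          pderivList (List.ofFn ι) (steinSol d h) y| ≤
        L * (2 ^ (α / 2 + 1) * ((α + d + 1) / α) * Real.Gamma ((α + d) / 2) /
              Real.Gamma (d / 2) + 2 / (α - β)) * dist x y ^ β := by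
  intro β hβ ι x y
  have hι : List.ofFn ι = ι 0 :: ι 1 :: List.ofFn fun k : Fin p => ι k.succ.succ := by
    rw [List.ofFn_succ, List.ofFn_succ]
    rfl
  set l := List.ofFn fun k : Fin p => ι k.succ.succ with hl
  have hlen : (ι 1 :: l).length + 1 = p + 2 := by simp [hl]
  have key := abs_integral_weight_mul_sub_le hd hβ hL0 (hsmooth.pderivList l)
    (hsupp.pderivList l) (hL fun k => ι k.succ.succ) p (ι 0) (ι 1) x y
  rw [hι, pderivList_steinSol hd hsmooth hsupp, hlen]
  simp only [neg_sub_neg]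
  rw [abs_sub_comm]
  refine key.trans_eq ?_
  rw [Real.rpow_add_one two_ne_zero]
  ring
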